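/- arXiv:2303.02491 — 9 statements merged into one kernel-verified Lean document; each statement's English description precedes it below -/
import Mathlib

section
/- Let G be an undirected graph with m edges and let p ∈ Δ^m be a probability distribution on the edges. Define edge weights w_e = (p_e + 1/m)^{-1} and let L = BᵀWB be the corresponding weighted Laplacian. Then for every edge e, load_w(e) = w_e Σ_{f∈E} |b_e L⁺ b_fᵀ| ≤ √(2m). -/
open Matrix

/-- Signed edge–vertex incidence matrix of an oriented graph whose `e`-th edge
goes from `(ends e).1` to `(ends e).2`. -/
noncomputable def incB {n m : ℕ} (ends : Fin m → Fin n × Fin n) :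
    Matrix (Fin m) (Fin n) ℝ :=
  fun e v =>
    (if v = (ends e).1 then (1 : ℝ) else 0) - (if v = (ends e).2 then (1 : ℝ) else 0)

/-- `P` is the Moore–Penrose pseudoinverse of `A` (real matrices): the four
Penrose conditions. -/
def IsMoorePenrose {k : ℕ} (A P : Matrix (Fin k) (Fin k) ℝ) : Prop :=
  A * P * A = A ∧ P * A * P = P ∧ (A * P)ᵀ = A * P ∧ (P * A)ᵀ = P * A

/-- The undirected simple graph underlying the oriented edge list `ends`. -/
def graphOf {n m : ℕ} (ends : Fin m → Fin n × Fin n) : SimpleGraph (Fin n) :=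
  SimpleGraph.fromRel fun u v => ∃ e, ends e = (u, v)

theorem mp_aux {k : ℕ} (L P : Matrix (Fin k) (Fin k) ℝ) (hL : Lᵀ = L)
    (h : IsMoorePenrose L P) : P * L * Pᵀ = P := by
  obtain ⟨h1, h2, h3, h4⟩ := h
  have h3' : Pᵀ * L = L * P := by rw [← h3, transpose_mul, hL]
  have h4' : L * Pᵀ = P * L := by rw [← h4, transpose_mul, hL]
  have h1' : L * Pᵀ * L = L := by
    have := congrArg transpose h1
    rw [transpose_mul, transpose_mul, hL, ← mul_assoc] at this
    exact this
  have a : P * L = P * L * (L * P) := by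
    calc P * L = P * (L * Pᵀ * L) := by rw [h1']
      _ = P * L * (Pᵀ * L) := by simp only [mul_assoc]
      _ = _ := by rw [h3']
  have b : L * P = P * L * (L * P) := by
    calc L * P = (L * Pᵀ * L) * P := by rw [h1']
      _ = (L * Pᵀ) * (L * P) := by simp only [mul_assoc]
      _ = _ := by rw [h4']
  have c : P * L = L * P := a.trans b.symm
  rw [mul_assoc, h4', c, ← mul_assoc, h2]

/-- width bound for the load. With weights `w_e = (p_e + 1/m)⁻¹`
for a probability distribution `p` on the edges, every edge has load at most
`√(2m)`. -/
theorem load_width_bound {n m : ℕ} (hm : 0 < m)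
    (ends : Fin m → Fin n × Fin n)
    (hloop : ∀ e, (ends e).1 ≠ (ends e).2)
    (hsimple : Function.Injective fun e => s((ends e).1, (ends e).2))
    (p : Fin m → ℝ) (hp : ∀ e, 0 ≤ p e) (hpsum : ∑ e, p e = 1)
    (Lplus : Matrix (Fin n) (Fin n) ℝ)
    (hMP : IsMoorePenrose
      ((incB ends)ᵀ * Matrix.diagonal (fun e => (p e + 1 / m)⁻¹) * incB ends) Lplus) :
    ∀ e : Fin m,
      (p e + 1 / m)⁻¹ * ∑ f : Fin m, |(incB ends * Lplus * (incB ends)ᵀ) e f|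
        ≤ Real.sqrt (2 * m) := by
  intro e
  have hm' : (0:ℝ) < m := by exact_mod_cast hm
  have hq : ∀ f, 0 < p f + 1 / (m:ℝ) := fun f => by
    have := hp f
    positivity
  have hkey := mp_aux _ _ (by
    simp only [transpose_mul, transpose_transpose, diagonal_transpose, Matrix.mul_assoc]) hMP
  generalize incB ends = B at *
  have hN : (B * Lplus * Bᵀ) * Matrix.diagonal (fun e => (p e + 1 / (m:ℝ))⁻¹)
      * (B * Lplus * Bᵀ)ᵀ = B * Lplus * Bᵀ := by
    conv_rhs => rw [← hkey]
    simp only [transpose_mul, transpose_transpose, Matrix.mul_assoc]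
  generalize B * Lplus * Bᵀ = N at *
  have hee : ∑ f, (p f + 1 / (m:ℝ))⁻¹ * N e f ^ 2 = N e e := by
    have := congrFun (congrFun hN e) e
    rw [Matrix.mul_apply] at this
    rw [← this]
    refine Finset.sum_congr rfl fun f _ => ?_
    rw [Matrix.mul_diagonal, transpose_apply]
    ring
  have hqs : ∑ f, (p f + 1 / (m:ℝ)) = 2 := by
    rw [Finset.sum_add_distrib, hpsum]
    simp
    field_simp
    norm_num
  have hcs : (∑ f, |N e f|) ^ 2 ≤ N e e * 2 := by
    rw [← hee, ← hqs]
    refine Finset.sum_sq_le_sum_mul_sum_of_sq_le_mul _ ?_ ?_ ?_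
    · intro f _
      have := hq f
      positivity
    · intro f _
      exact (hq f).le
    · intro f _
      have := (hq f).ne'
      rw [sq_abs, mul_right_comm, inv_mul_cancel₀ this, one_mul]
  have hle : (p e + 1 / (m:ℝ))⁻¹ * N e e ^ 2 ≤ N e e := by
    conv_rhs => rw [← hee]
    refine Finset.single_le_sum (f := fun f => (p f + 1 / (m:ℝ))⁻¹ * N e f ^ 2) ?_ (Finset.mem_univ e)
    intro f _
    have := hq f
    positivity
  have hw : (p e + 1 / (m:ℝ))⁻¹ ≤ m := by
    rw [inv_le_comm₀ (hq e) hm', ← one_div]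
    linarith [hp e]
  have hw0 : 0 < (p e + 1 / (m:ℝ))⁻¹ := inv_pos.mpr (hq e)
  generalize (p e + 1 / (m:ℝ))⁻¹ = w at *
  generalize N e e = x at *
  have hx0 : 0 ≤ x := le_trans (by positivity) hle
  have hx1 : w * x ≤ 1 := by
    rcases hx0.eq_or_lt with h | h
    · rw [← h]; simp
    · have : (w * x) * x ≤ 1 * x := by nlinarith
      exact le_of_mul_le_mul_right this h
  apply Real.le_sqrt_of_sq_le
  calc (w * ∑ f, |N e f|) ^ 2 = w ^ 2 * (∑ f, |N e f|) ^ 2 := by ring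
    _ ≤ w ^ 2 * (x * 2) := by gcongr
    _ = 2 * w * (w * x) := by ring
    _ ≤ 2 * w * 1 := by gcongr
    _ ≤ 2 * m := by linarith
end

section
/- Let G be an undirected graph with m edges and let p ∈ Δ^m be a probability distribution on the edges. Define edge weights w_e = p_e + 1/m and let L = BᵀWB be the corresponding weighted Laplacian. Then for every edge e, stretch_w(e) = Σ_{f∈E} w_f |b_e L⁺ b_fᵀ| ≤ √(2m). -/
open Matrix

lemma mp_symm {k : ℕ} (L P : Matrix (Fin k) (Fin k) ℝ) (hL : Lᵀ = L)
    (h : IsMoorePenrose L P) : Pᵀ = P := by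
  obtain ⟨h1, h2, h3, h4⟩ := h
  have a : Pᵀ * L = L * P := by rw [← h3, transpose_mul, hL]
  have b : L * Pᵀ = P * L := by rw [← h4, transpose_mul, hL]
  have q1 : L * Pᵀ * L = L := by
    have := congrArg transpose h1
    simpa [transpose_mul, hL, Matrix.mul_assoc] using this
  have q2 : Pᵀ * L * Pᵀ = Pᵀ := by
    have := congrArg transpose h2
    simpa [transpose_mul, hL, Matrix.mul_assoc] using this
  have c : L * P = P * L := by
    have e1 : L * P = (P * L) * (L * P) := by
      rw [← b, ← Matrix.mul_assoc, q1]
    have e2 : (L * P) * (P * L) = P * L := by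
      rw [← b, ← Matrix.mul_assoc, h1]
    have e3 := congrArg transpose e1
    rw [h3, transpose_mul, h3, h4, e2] at e3
    exact e3
  calc Pᵀ = Pᵀ * L * Pᵀ := q2.symm
    _ = P * L * Pᵀ := by rw [a, c]
    _ = P * L * P := by rw [Matrix.mul_assoc, Matrix.mul_assoc P L P, b, c]
    _ = P := h2

/-- width bound for the stretch. With weights `w_e = p_e + 1/m`
for a probability distribution `p` on the edges, every edge has stretch at most
`√(2m)`. -/
theorem stretch_width_bound {n m : ℕ} (hm : 0 < m)
    (ends : Fin m → Fin n × Fin n)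
    (hloop : ∀ e, (ends e).1 ≠ (ends e).2)
    (hsimple : Function.Injective fun e => s((ends e).1, (ends e).2))
    (p : Fin m → ℝ) (hp : ∀ e, 0 ≤ p e) (hpsum : ∑ e, p e = 1)
    (Lplus : Matrix (Fin n) (Fin n) ℝ)
    (hMP : IsMoorePenrose
      ((incB ends)ᵀ * Matrix.diagonal (fun e => p e + 1 / m) * incB ends) Lplus) :
    ∀ e : Fin m,
      ∑ f : Fin m, (p f + 1 / m) * |(incB ends * Lplus * (incB ends)ᵀ) e f|
        ≤ Real.sqrt (2 * m) := by
  intro e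
  set B := incB ends with hB
  set w : Fin m → ℝ := fun e => p e + 1 / m with hw
  have hm' : (0 : ℝ) < m := by exact_mod_cast hm
  have hwpos : ∀ f, 0 < w f := fun f => by
    have := hp f
    have : (0 : ℝ) < 1 / m := by positivity
    simp only [hw]; linarith [hp f]
  have hwge : ∀ f, 1 / (m : ℝ) ≤ w f := fun f => by
    simp only [hw]; linarith [hp f]
  have hwsum : ∑ f, w f = 2 := by
    simp only [hw, Finset.sum_add_distrib, hpsum, Finset.sum_const, Finset.card_univ,
      Fintype.card_fin, nsmul_eq_mul]
    field_simp
    norm_num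
  have hL : (Bᵀ * diagonal w * B)ᵀ = Bᵀ * diagonal w * B := by
    simp [transpose_mul, Matrix.mul_assoc]
  have hP := mp_symm _ _ hL hMP
  set M := B * Lplus * Bᵀ with hM
  have hMs : Mᵀ = M := by
    simp [hM, transpose_mul, Matrix.mul_assoc, hP]
  have hMM : M * diagonal w * M = M := by
    calc M * diagonal w * M
        = B * (Lplus * (Bᵀ * diagonal w * B) * Lplus) * Bᵀ := by
          simp only [hM, Matrix.mul_assoc]
      _ = M := by rw [hMP.2.1]
  have hdiag : ∑ f, w f * M e f ^ 2 = M e e := by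
    have h := congrFun (congrFun hMM e) e
    rw [Matrix.mul_apply] at h
    rw [← h]
    refine Finset.sum_congr rfl fun f _ => ?_
    have : M f e = M e f := congrFun (congrFun hMs e) f
    rw [Matrix.mul_diagonal, this]; ring
  have hle : w e * M e e ^ 2 ≤ M e e := by
    conv_rhs => rw [← hdiag]
    exact Finset.single_le_sum (f := fun f => w f * M e f ^ 2)
      (fun f _ => mul_nonneg (hwpos f).le (sq_nonneg _)) (Finset.mem_univ e)
  have hMm : M e e ≤ m := by
    by_contra! hc
    have h1 : 1 / (m : ℝ) * M e e ^ 2 ≤ M e e :=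
      le_trans (mul_le_mul_of_nonneg_right (hwge e) (sq_nonneg _)) hle
    rw [one_div, inv_mul_le_iff₀ hm'] at h1
    nlinarith
  apply Real.le_sqrt_of_sq_le
  have hcs := Finset.sum_mul_sq_le_sq_mul_sq Finset.univ (fun f => √(w f))
    (fun f => √(w f) * |M e f|)
  have e1 : ∀ f, √(w f) * (√(w f) * |M e f|) = w f * |M e f| := fun f => by
    rw [← mul_assoc, Real.mul_self_sqrt (hwpos f).le]
  have e2 : ∀ f, (√(w f) * |M e f|) ^ 2 = w f * M e f ^ 2 := fun f => by
    rw [mul_pow, Real.sq_sqrt (hwpos f).le, sq_abs]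
  have e3 : ∀ f, √(w f) ^ 2 = w f := fun f => Real.sq_sqrt (hwpos f).le
  simp only [e1, e2, e3, hwsum, hdiag] at hcs
  refine le_trans hcs ?_
  linarith
end

section
/- Let G be an undirected graph with m edges, let p ∈ Δ^m, define edge weights w_e = (p_e + 1/m)^{-1}, and let L = BᵀWB be the corresponding weighted Laplacian. Suppose the localization inequality holds for these weights with constant α > 0, i.e., for every vector ℓ ∈ ℝ^m_{≥0}, Σ_{e,f∈E} ℓ_e ℓ_f √(w_e w_f) |b_e L⁺ b_fᵀ| ≤ α · ‖ℓ‖₂². Then Σ_{e∈E} p_e · load_w(e) ≤ 2α, where load_w(e) = w_e Σ_{f∈E} |b_e L⁺ b_fᵀ|. -/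
open Matrix

/-- assuming the localization inequality with constant `α` for the
weights `w_e = (p_e + 1/m)⁻¹`, the `p`-average load is at most `2α`. -/
theorem average_load_bound {n m : ℕ} (hm : 0 < m)
    (ends : Fin m → Fin n × Fin n)
    (hloop : ∀ e, (ends e).1 ≠ (ends e).2)
    (hsimple : Function.Injective fun e => s((ends e).1, (ends e).2))
    (p : Fin m → ℝ) (hp : ∀ e, 0 ≤ p e) (hpsum : ∑ e, p e = 1)
    (Lplus : Matrix (Fin n) (Fin n) ℝ)
    (hMP : IsMoorePenrose
      ((incB ends)ᵀ * Matrix.diagonal (fun e => (p e + 1 / m)⁻¹) * incB ends) Lplus)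
    (α : ℝ) (hα : 0 < α)
    (hloc : ∀ l : Fin m → ℝ, (∀ e, 0 ≤ l e) →
      ∑ e : Fin m, ∑ f : Fin m,
          l e * l f * Real.sqrt ((p e + 1 / m)⁻¹ * (p f + 1 / m)⁻¹) *
            |(incB ends * Lplus * (incB ends)ᵀ) e f|
        ≤ α * ∑ e : Fin m, (l e) ^ 2) :
    ∑ e : Fin m,
        p e * ((p e + 1 / m)⁻¹ * ∑ f : Fin m, |(incB ends * Lplus * (incB ends)ᵀ) e f|)
      ≤ 2 * α := by
  have hm' : (0 : ℝ) < m := by exact_mod_cast hm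
  have hq : ∀ e, 0 < p e + 1 / (m : ℝ) := fun e => by
    have := hp e
    positivity
  have h := hloc (fun e => Real.sqrt (p e + 1 / m)) (fun e => Real.sqrt_nonneg _)
  have hs : ∑ e : Fin m, (Real.sqrt (p e + 1 / m)) ^ 2 = 2 := by
    have h1 : ∀ e : Fin m, (Real.sqrt (p e + 1 / m)) ^ 2 = p e + 1 / m :=
      fun e => Real.sq_sqrt (hq e).le
    simp only [h1, Finset.sum_add_distrib, hpsum, Finset.sum_const, Finset.card_univ,
      Fintype.card_fin, nsmul_eq_mul]
    field_simp
    norm_num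
  have h1 : ∀ e f : Fin m, Real.sqrt (p e + 1 / m) * Real.sqrt (p f + 1 / m) *
      Real.sqrt ((p e + 1 / m)⁻¹ * (p f + 1 / m)⁻¹) = 1 := by
    intro e f
    rw [← Real.sqrt_mul (hq e).le, ← mul_inv, ← Real.sqrt_mul (mul_pos (hq e) (hq f)).le,
      mul_inv_cancel₀ (mul_pos (hq e) (hq f)).ne', Real.sqrt_one]
  simp only [h1, one_mul, hs] at h
  refine le_trans (Finset.sum_le_sum fun e _ => ?_) (h.trans_eq (mul_comm _ _))
  rw [← mul_assoc]
  refine mul_le_of_le_one_left (Finset.sum_nonneg fun f _ => abs_nonneg _) ?_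
  rw [← div_eq_mul_inv, div_le_one (hq e)]
  have : 0 < 1 / (m : ℝ) := by positivity
  linarith
end

section
/- Let G be an undirected graph with m edges, let p ∈ Δ^m, define edge weights w_e = p_e + 1/m, and let L = BᵀWB be the corresponding weighted Laplacian. Suppose the localization inequality holds for these weights with constant α > 0, i.e., for every vector ℓ ∈ ℝ^m_{≥0}, Σ_{e,f∈E} ℓ_e ℓ_f √(w_e w_f) |b_e L⁺ b_fᵀ| ≤ α · ‖ℓ‖₂². Then Σ_{e∈E} p_e · stretch_w(e) ≤ 2α, where stretch_w(e) = Σ_{f∈E} w_f |b_e L⁺ b_fᵀ|. -/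
open Matrix

/-- assuming the localization inequality with constant `α` for the
weights `w_e = p_e + 1/m`, the `p`-average stretch is at most `2α`. -/
theorem average_stretch_bound {n m : ℕ} (hm : 0 < m)
    (ends : Fin m → Fin n × Fin n)
    (hloop : ∀ e, (ends e).1 ≠ (ends e).2)
    (hsimple : Function.Injective fun e => s((ends e).1, (ends e).2))
    (p : Fin m → ℝ) (hp : ∀ e, 0 ≤ p e) (hpsum : ∑ e, p e = 1)
    (Lplus : Matrix (Fin n) (Fin n) ℝ)
    (hMP : IsMoorePenrose
      ((incB ends)ᵀ * Matrix.diagonal (fun e => p e + 1 / m) * incB ends) Lplus)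
    (α : ℝ) (hα : 0 < α)
    (hloc : ∀ l : Fin m → ℝ, (∀ e, 0 ≤ l e) →
      ∑ e : Fin m, ∑ f : Fin m,
          l e * l f * Real.sqrt ((p e + 1 / m) * (p f + 1 / m)) *
            |(incB ends * Lplus * (incB ends)ᵀ) e f|
        ≤ α * ∑ e : Fin m, (l e) ^ 2) :
    ∑ e : Fin m,
        p e * (∑ f : Fin m, (p f + 1 / m) * |(incB ends * Lplus * (incB ends)ᵀ) e f|)
      ≤ 2 * α := by
  have hw : ∀ e, 0 ≤ p e + 1 / (m : ℝ) := fun e => add_nonneg (hp e) (by positivity)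
  have h := hloc (fun e => Real.sqrt (p e + 1 / m)) (fun e => Real.sqrt_nonneg _)
  have hs : ∑ e : Fin m, (Real.sqrt (p e + 1 / (m : ℝ))) ^ 2 = 2 := by
    have hm' : (m : ℝ) ≠ 0 := by exact_mod_cast hm.ne'
    simp only [Real.sq_sqrt (hw _), Finset.sum_add_distrib, hpsum]
    simp [hm']
    norm_num
  rw [hs, mul_comm] at h
  refine le_trans (Finset.sum_le_sum fun e _ => ?_) h
  rw [Finset.mul_sum]
  refine Finset.sum_le_sum fun f _ => ?_
  rw [← Real.sqrt_mul (hw e), Real.mul_self_sqrt (mul_nonneg (hw e) (hw f)), mul_assoc]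
  refine mul_le_mul_of_nonneg_right ?_ (mul_nonneg (hw f) (abs_nonneg _))
  have : 0 ≤ 1 / (m : ℝ) := by positivity
  linarith
end

section
/- Let G be a connected undirected graph with n vertices and positive edge weights w, and let w_max denote the maximum edge weight. Then for every edge e, load_w(e) ≥ 2 w_e / (n · w_max), where load_w(e) = w_e Σ_{f∈E} |b_e L⁺ b_fᵀ| and L = BᵀWB is the weighted Laplacian. -/
open Matrix

theorem B_mul_proj {n m : ℕ} (B : Matrix (Fin m) (Fin n) ℝ) (w : Fin m → ℝ) (hw : ∀ e, 0 < w e)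
    (Z : Matrix (Fin n) (Fin n) ℝ) (h : Bᵀ * Matrix.diagonal w * B * Z = 0) : B * Z = 0 := by
  have h2 : (B * Z)ᵀ * (Matrix.diagonal w * (B * Z)) = 0 := by
    rw [Matrix.transpose_mul]
    have : Zᵀ * Bᵀ * (Matrix.diagonal w * (B * Z)) = Zᵀ * (Bᵀ * Matrix.diagonal w * B * Z) := by
      simp only [Matrix.mul_assoc]
    rw [this, h, Matrix.mul_zero]
  ext f v
  have h3 := congrFun (congrFun h2 v) v
  rw [Matrix.mul_apply] at h3
  simp only [Matrix.diagonal_mul, Matrix.transpose_apply, Matrix.zero_apply] at h3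
  have h4 := (Finset.sum_eq_zero_iff_of_nonneg (fun g _ => by
    have := hw g
    nlinarith [mul_nonneg this.le (mul_self_nonneg ((B * Z) g v))])).1 h3 f (Finset.mem_univ f)
  have := hw f
  have h5 : w f * ((B * Z) f v * (B * Z) f v) = 0 := by linarith
  simpa [this.ne'] using h5

/-- lower bound on the load of every edge in a connected graph:
`load_w(e) ≥ 2 w_e / (n · w_max)`. -/
theorem load_lower_bound {n m : ℕ}
    (ends : Fin m → Fin n × Fin n)
    (hloop : ∀ e, (ends e).1 ≠ (ends e).2)
    (hsimple : Function.Injective fun e => s((ends e).1, (ends e).2))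
    (hconn : (graphOf ends).Connected)
    (w : Fin m → ℝ) (hw : ∀ e, 0 < w e)
    (wmax : ℝ) (hwmax_ub : ∀ f, w f ≤ wmax) (hwmax_mem : ∃ f, w f = wmax)
    (Lplus : Matrix (Fin n) (Fin n) ℝ)
    (hMP : IsMoorePenrose ((incB ends)ᵀ * Matrix.diagonal w * incB ends) Lplus) :
    ∀ e : Fin m,
      w e * ∑ f : Fin m, |(incB ends * Lplus * (incB ends)ᵀ) e f|
        ≥ 2 * w e / (n * wmax) := by
  intro e
  obtain ⟨h1, -, -, -⟩ := hMP
  set B := incB ends with hB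
  have hZ : B * (Lplus * (Bᵀ * Matrix.diagonal w * B) - 1) = 0 := by
    apply B_mul_proj B w hw
    rw [Matrix.mul_sub, ← Matrix.mul_assoc, h1, Matrix.mul_one, sub_self]
  have hE : (B * Lplus * Bᵀ) * (Matrix.diagonal w * B) = B := by
    rw [Matrix.mul_sub, Matrix.mul_one, sub_eq_zero] at hZ
    simp only [Matrix.mul_assoc]
    simp only [Matrix.mul_assoc] at hZ
    exact hZ
  have hv := congrFun (congrFun hE e) (ends e).1
  rw [Matrix.mul_apply] at hv
  simp only [Matrix.diagonal_mul] at hv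
  have hBe : B e (ends e).1 = 1 := by
    simp [hB, incB, hloop e]
  rw [hBe] at hv
  have hBabs : ∀ f v, |B f v| ≤ 1 := by
    intro f v
    simp only [hB, incB]
    split_ifs <;> norm_num
  have hm : 0 < wmax := (hw e).trans_le (hwmax_ub e)
  have hle : 1 ≤ wmax * ∑ f : Fin m, |(B * Lplus * Bᵀ) e f| := by
    rw [← hv, Finset.mul_sum]
    apply Finset.sum_le_sum
    intro f _
    refine (le_abs_self _).trans ?_
    rw [abs_mul, abs_mul, abs_of_pos (hw f), mul_comm]
    apply mul_le_mul_of_nonneg_right _ (abs_nonneg _)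
    have := mul_le_mul (hwmax_ub f) (hBabs f (ends e).1) (abs_nonneg _) hm.le
    linarith
  have hn : (2 : ℝ) ≤ n := by
    have : 2 ≤ n := by
      have h := hloop e
      have h1 := (ends e).1.isLt
      have h2 := (ends e).2.isLt
      have h3 : ((ends e).1 : ℕ) ≠ (ends e).2 := fun h' => h (Fin.ext h')
      omega
    exact_mod_cast this
  have hS : 0 ≤ ∑ f : Fin m, |(B * Lplus * Bᵀ) e f| := Finset.sum_nonneg fun _ _ => abs_nonneg _
  generalize (∑ f : Fin m, |(B * Lplus * Bᵀ) e f|) = S at hle hS ⊢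
  rw [ge_iff_le, div_le_iff₀ (by positivity)]
  have h6 : 2 * 1 ≤ (n : ℝ) * (wmax * S) := mul_le_mul hn hle (by norm_num) (by positivity)
  nlinarith [mul_le_mul_of_nonneg_left h6 (hw e).le]
end

section
/- Let G be a connected undirected graph with n ≥ 2 vertices and let L be its (unit-weight) Laplacian matrix. Then for every x ∈ ℝⁿ with x ⊥ 𝟙 (i.e., Σ_i x_i = 0), one has xᵀLx ≥ n^{-3} · ‖x‖₂². -/
open Matrix

/-- squared difference along an unordered pair -/
noncomputable def sqDiff {n : ℕ} (x : Fin n → ℝ) : Sym2 (Fin n) → ℝ :=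
  Sym2.lift ⟨fun u v => (x u - x v) ^ 2, fun u v => by ring⟩

theorem sqDiff_nonneg {n : ℕ} (x : Fin n → ℝ) (z : Sym2 (Fin n)) : 0 ≤ sqDiff x z := by
  induction z with
  | _ u v => exact sq_nonneg (x u - x v)

theorem walk_bound {n : ℕ} {G : SimpleGraph (Fin n)} (x : Fin n → ℝ) (t : ℝ) {u v : Fin n}
    (p : G.Walk u v) :
    2 * t * (x u - x v) ≤ t ^ 2 * p.length + (p.edges.map (sqDiff x)).sum := by
  induction p with
  | nil => simp
  | @cons a b c h p ih =>
    simp only [SimpleGraph.Walk.length_cons, SimpleGraph.Walk.edges_cons, List.map_cons,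
      List.sum_cons]
    have : sqDiff x s(a, b) = (x a - x b) ^ 2 := rfl
    rw [this]
    push_cast
    nlinarith [sq_nonneg (t - (x a - x b))]

theorem quad_eq {n m : ℕ} (ends : Fin m → Fin n × Fin n) (x : Fin n → ℝ) :
    x ⬝ᵥ ((incB ends)ᵀ * incB ends).mulVec x
      = ∑ e, sqDiff x s((ends e).1, (ends e).2) := by
  rw [← Matrix.mulVec_mulVec, Matrix.dotProduct_mulVec, Matrix.vecMul_transpose]
  unfold dotProduct
  refine Finset.sum_congr rfl fun e _ => ?_
  have h : (incB ends *ᵥ x) e = x (ends e).1 - x (ends e).2 := by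
    simp [Matrix.mulVec, dotProduct, incB, sub_mul, Finset.sum_sub_distrib]
  rw [h, ← sq]
  rfl

theorem pair_bound {n m : ℕ} (ends : Fin m → Fin n × Fin n)
    (hsimple : Function.Injective fun e => s((ends e).1, (ends e).2))
    (hconn : (graphOf ends).Connected) (x : Fin n → ℝ) (u v : Fin n) :
    (x u - x v) ^ 2 ≤ n * ∑ e, sqDiff x s((ends e).1, (ends e).2) := by
  obtain ⟨p, hp⟩ := (hconn.preconnected u v).exists_isPath
  have hlen : (p.length : ℝ) ≤ n := by
    have := hp.length_lt
    rw [Fintype.card_fin] at this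
    exact_mod_cast this.le
  have hsum : (p.edges.map (sqDiff x)).sum ≤ ∑ e, sqDiff x s((ends e).1, (ends e).2) := by
    rw [← List.sum_toFinset _ hp.isTrail.edges_nodup,
      ← Finset.sum_image (s := Finset.univ) (f := sqDiff x)
        (g := fun e => s((ends e).1, (ends e).2)) (fun a _ b _ h => hsimple h)]
    refine Finset.sum_le_sum_of_subset_of_nonneg ?_ fun i _ _ => sqDiff_nonneg x i
    intro z hz
    have hz' := p.edges_subset_edgeSet (List.mem_toFinset.1 hz)
    induction z with
    | _ a b =>
      rw [SimpleGraph.mem_edgeSet, graphOf, SimpleGraph.fromRel_adj] at hz'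
      rcases hz'.2 with ⟨e, he⟩ | ⟨e, he⟩
      · exact Finset.mem_image.2 ⟨e, Finset.mem_univ _, by simp [he]⟩
      · exact Finset.mem_image.2 ⟨e, Finset.mem_univ _, by simp [he, Sym2.eq_swap]⟩
  have hn : (0 : ℝ) < n := by
    have := u.pos
    exact_mod_cast this
  have h := walk_bound x ((x u - x v) / n) p
  have h2 : ((x u - x v) / n) ^ 2 * p.length ≤ ((x u - x v) / n) ^ 2 * n := by gcongr
  have h3 : 2 * ((x u - x v) / n) * (x u - x v) - ((x u - x v) / n) ^ 2 * n
      = (x u - x v) ^ 2 / n := by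
    field_simp
    ring
  have h4 : (x u - x v) ^ 2 / n ≤ ∑ e, sqDiff x s((ends e).1, (ends e).2) := by linarith
  rw [div_le_iff₀ hn] at h4
  linarith

/-- for a connected graph on `n ≥ 2` vertices and `x ⊥ 𝟙`,
`xᵀ L x ≥ n⁻³ · ‖x‖₂²` for the unit-weight Laplacian `L = BᵀB`. -/
theorem lap_quadratic_form_lower_bound {n m : ℕ} (hn : 2 ≤ n)
    (ends : Fin m → Fin n × Fin n)
    (hloop : ∀ e, (ends e).1 ≠ (ends e).2)
    (hsimple : Function.Injective fun e => s((ends e).1, (ends e).2))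
    (hconn : (graphOf ends).Connected) :
    ∀ x : Fin n → ℝ, ∑ i, x i = 0 →
      x ⬝ᵥ ((incB ends)ᵀ * incB ends).mulVec x ≥ ((n : ℝ) ^ 3)⁻¹ * ∑ i, (x i) ^ 2 := by
  intro x hx
  rw [quad_eq, ge_iff_le]
  have hp := pair_bound ends hsimple hconn x
  set Q := ∑ e, sqDiff x s((ends e).1, (ends e).2) with hQ
  have hQ0 : 0 ≤ Q := Finset.sum_nonneg fun e _ => sqDiff_nonneg x _
  have hn' : (2 : ℝ) ≤ n := by exact_mod_cast hn
  have h1 : ∑ u, ∑ v, (x u - x v) ^ 2 ≤ ∑ _u : Fin n, ∑ _v : Fin n, (n : ℝ) * Q :=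
    Finset.sum_le_sum fun u _ => Finset.sum_le_sum fun v _ => hp u v
  have h2 : ∑ u, ∑ v, (x u - x v) ^ 2 = 2 * n * ∑ i, x i ^ 2 := by
    simp only [sub_sq, Finset.sum_add_distrib, Finset.sum_sub_distrib, ← Finset.mul_sum, hx]
    simp [← Finset.mul_sum]
    ring
  rw [h2] at h1
  simp only [Finset.sum_const, Finset.card_univ, Fintype.card_fin, nsmul_eq_mul] at h1
  rw [inv_mul_le_iff₀ (by positivity)]
  have hS : 0 ≤ ∑ i, x i ^ 2 := Finset.sum_nonneg fun i _ => sq_nonneg _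
  nlinarith
end

section
/- Let G be a connected undirected graph with n ≥ 2 vertices and Laplacian L, and let ε > 0. Suppose x, y ∈ ℝⁿ satisfy x ⊥ 𝟙, y ⊥ 𝟙, and ‖x − y‖_L ≤ ε · ‖y‖_L. Then ‖x − y‖_∞ ≤ ε · 2n³ · ‖y‖_∞. -/
open Matrix

lemma aux_quad {n m : ℕ} (ends : Fin m → Fin n × Fin n) (z : Fin n → ℝ) :
    z ⬝ᵥ ((incB ends)ᵀ * incB ends).mulVec z = ∑ e, (z (ends e).1 - z (ends e).2) ^ 2 := by
  rw [← Matrix.mulVec_mulVec, Matrix.dotProduct_mulVec, Matrix.vecMul_transpose]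
  have h : ∀ e, (incB ends).mulVec z e = z (ends e).1 - z (ends e).2 := by
    intro e
    simp [Matrix.mulVec, dotProduct, incB, sub_mul, Finset.sum_sub_distrib]
  simp only [dotProduct, h, sq]

lemma aux_walk {n m : ℕ} (ends : Fin m → Fin n × Fin n) (z : Fin n → ℝ) (S : ℝ)
    (hS : ∀ e, |z (ends e).1 - z (ends e).2| ≤ S) {u v : Fin n} (w : (graphOf ends).Walk u v) :
    |z u - z v| ≤ w.length * S := by
  induction w with
  | nil => simp
  | @cons a b c h p ih =>
    have hab : |z a - z b| ≤ S := by
      rw [graphOf, SimpleGraph.fromRel_adj] at h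
      obtain ⟨-, ⟨e, he⟩ | ⟨e, he⟩⟩ := h
      · have := hS e
        rwa [he] at this
      · have := hS e
        rw [he] at this
        rwa [abs_sub_comm]
    have := abs_sub_le (z a) (z b) (z c)
    rw [SimpleGraph.Walk.length_cons]
    push_cast
    linarith

/-- if `x, y ⊥ 𝟙` and `‖x − y‖_L ≤ ε ‖y‖_L` on a connected graph
with `n ≥ 2` vertices, then `‖x − y‖_∞ ≤ ε · 2n³ · ‖y‖_∞`.
(Note `‖·‖` is the sup norm for vectors in `Fin n → ℝ`.) -/
theorem infty_close_of_lapNorm_close {n m : ℕ} (hn : 2 ≤ n)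
    (ends : Fin m → Fin n × Fin n)
    (hloop : ∀ e, (ends e).1 ≠ (ends e).2)
    (hsimple : Function.Injective fun e => s((ends e).1, (ends e).2))
    (hconn : (graphOf ends).Connected)
    -- unit-weight Laplacian
    (ε : ℝ) (hε : 0 < ε)
    (x y : Fin n → ℝ) (hx : ∑ i, x i = 0) (hy : ∑ i, y i = 0)
    (hclose :
      Real.sqrt ((x - y) ⬝ᵥ ((incB ends)ᵀ * incB ends).mulVec (x - y))
        ≤ ε * Real.sqrt (y ⬝ᵥ ((incB ends)ᵀ * incB ends).mulVec y)) :
    ‖x - y‖ ≤ ε * (2 * (n : ℝ) ^ 3) * ‖y‖ := by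
  rw [aux_quad, aux_quad] at hclose
  set z := x - y with hz
  set S := Real.sqrt (∑ e, (z (ends e).1 - z (ends e).2) ^ 2) with hSdef
  have hS0 : 0 ≤ S := Real.sqrt_nonneg _
  have hn0 : (2 : ℝ) ≤ n := by exact_mod_cast hn
  have hS : ∀ e, |z (ends e).1 - z (ends e).2| ≤ S := by
    intro e
    apply Real.abs_le_sqrt
    exact Finset.single_le_sum (f := fun e => (z (ends e).1 - z (ends e).2) ^ 2)
      (fun i _ => sq_nonneg _) (Finset.mem_univ e)
  have hd : ∀ u v, |z u - z v| ≤ n * S := by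
    intro u v
    obtain ⟨p⟩ := hconn.preconnected u v
    classical
    have h1 := aux_walk ends z S hS (p.toPath : (graphOf ends).Walk u v)
    have h2 := p.toPath.2.length_lt
    rw [Fintype.card_fin] at h2
    have h3 : (((p.toPath : (graphOf ends).Walk u v).length : ℕ) : ℝ) ≤ n := by
      exact_mod_cast h2.le
    exact h1.trans (mul_le_mul_of_nonneg_right h3 hS0)
  have hzs : ∑ i, z i = 0 := by simp [hz, Finset.sum_sub_distrib, hx, hy]
  have hb : ∀ u, |z u| ≤ n * S := by
    intro u
    have e1 : (n : ℝ) * z u = ∑ v, (z u - z v) := by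
      simp [Finset.sum_sub_distrib, hzs]
    have e2 : (n : ℝ) * |z u| ≤ n * (n * S) := by
      calc (n : ℝ) * |z u| = |∑ v, (z u - z v)| := by
            rw [← e1, abs_mul, Nat.abs_cast]
        _ ≤ ∑ v, |z u - z v| := Finset.abs_sum_le_sum_abs _ _
        _ ≤ ∑ _v : Fin n, (n * S) := Finset.sum_le_sum fun v _ => hd u v
        _ = n * (n * S) := by simp
    exact le_of_mul_le_mul_left e2 (by linarith)
  have hm : m ≤ n * n := by
    have hinj : Function.Injective ends := by
      intro a b hab
      apply hsimple
      simp [hab]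
    simpa using Fintype.card_le_of_injective ends hinj
  have hm' : (m : ℝ) ≤ n * n := by exact_mod_cast hm
  have hy0 := norm_nonneg y
  have hQ : Real.sqrt (∑ e, (y (ends e).1 - y (ends e).2) ^ 2) ≤ 2 * n * ‖y‖ := by
    apply Real.sqrt_le_iff.2
    refine ⟨by positivity, ?_⟩
    calc ∑ e, (y (ends e).1 - y (ends e).2) ^ 2 ≤ ∑ _e : Fin m, (2 * ‖y‖) ^ 2 := by
          apply Finset.sum_le_sum
          intro e _
          apply sq_le_sq'
          all_goals
            have h1 := abs_le.1 (norm_le_pi_norm y (ends e).1)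
            have h2 := abs_le.1 (norm_le_pi_norm y (ends e).2)
            linarith [h1.1, h1.2, h2.1, h2.2]
      _ = m * (2 * ‖y‖) ^ 2 := by simp
      _ ≤ n * n * (2 * ‖y‖) ^ 2 := mul_le_mul_of_nonneg_right hm' (sq_nonneg _)
      _ = (2 * n * ‖y‖) ^ 2 := by ring
  have hSb : S ≤ ε * (2 * n * ‖y‖) :=
    hclose.trans (mul_le_mul_of_nonneg_left hQ hε.le)
  rw [pi_norm_le_iff_of_nonneg (by positivity)]
  intro u
  rw [Real.norm_eq_abs]
  calc |z u| ≤ n * S := hb u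
    _ ≤ n * (ε * (2 * n * ‖y‖)) := by gcongr
    _ = 1 * (ε * (2 * n ^ 2) * ‖y‖) := by ring
    _ ≤ n * (ε * (2 * n ^ 2) * ‖y‖) := by
        apply mul_le_mul_of_nonneg_right (by linarith) (by positivity)
    _ = ε * (2 * (n : ℝ) ^ 3) * ‖y‖ := by ring
end

section
/- Let m ≥ 2 and T be positive integers, let η ∈ (0, 1/2], and let y^{(1)}, …, y^{(T)} ∈ ℝ^m satisfy |y^{(t)}_e| ≤ 1 for all e ∈ [m] and t ∈ [T]. Define x^{(0)}_e = 1 and x^{(t)}_e = x^{(t−1)}_e · (1 − η · y^{(t)}_e). Suppose that for every t ∈ [T], Σ_{e∈[m]} x^{(t−1)}_e · y^{(t)}_e ≥ 0. Then for every coordinate e ∈ [m], Σ_{t=1}^{T} y^{(t)}_e + η · Σ_{t=1}^{T} |y^{(t)}_e| ≥ −(ln m)/η. -/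
theorem mwu_log_aux (z : ℝ) (hz : |z| ≤ 1 / 2) : -z - z ^ 2 ≤ Real.log (1 - z) := by
  have h := Real.abs_log_sub_add_sum_range_le (x := z) (by linarith) 4
  have h2 : |z| ^ (4 + 1) / (1 - |z|) ≤ z ^ 2 / 4 := by
    rw [div_le_iff₀ (by linarith)]
    have h0 := abs_nonneg z
    have h3 : |z| ^ 3 ≤ (1 / 2) ^ 3 := pow_le_pow_left₀ h0 hz 3
    have h4 : z ^ 2 * |z| ^ 3 ≤ z ^ 2 * (1 / 2) ^ 3 :=
      mul_le_mul_of_nonneg_left h3 (sq_nonneg z)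
    have h5 : |z| ^ (4 + 1) = z ^ 2 * |z| ^ 3 := by rw [← sq_abs z]; ring
    have h6 : z ^ 2 * |z| ≤ z ^ 2 * (1 / 2) := mul_le_mul_of_nonneg_left hz (sq_nonneg z)
    rw [h5]; nlinarith
  have h3 := (abs_le.mp (h.trans h2)).1
  simp [Finset.sum_range_succ] at h3
  obtain ⟨ha, hb⟩ := abs_le.mp hz
  have h7 : z ^ 2 * (z / 3 + z ^ 2 / 4) ≤ z ^ 2 * (1 / 4) :=
    mul_le_mul_of_nonneg_left (by nlinarith) (sq_nonneg z)
  norm_num at h3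
  nlinarith

/-- the per-coordinate regret bound of multiplicative weights:
under the update `x⁽ᵗ⁾_e = x⁽ᵗ⁻¹⁾_e (1 − η y⁽ᵗ⁾_e)` with `x⁽⁰⁾ = 𝟙`,
`|y⁽ᵗ⁾_e| ≤ 1` and nonnegative weighted averages, every coordinate satisfies
`Σ_t y⁽ᵗ⁾_e + η Σ_t |y⁽ᵗ⁾_e| ≥ −(ln m)/η`. -/
theorem mwu_regret_bound (m T : ℕ) (hm : 2 ≤ m) (hT : 0 < T)
    (η : ℝ) (hη0 : 0 < η) (hη1 : η ≤ 1 / 2)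
    (y x : ℕ → Fin m → ℝ)
    (hybound : ∀ t ∈ Finset.Icc 1 T, ∀ e, |y t e| ≤ 1)
    (hx0 : ∀ e, x 0 e = 1)
    (hxt : ∀ t ∈ Finset.Icc 1 T, ∀ e, x t e = x (t - 1) e * (1 - η * y t e))
    (havg : ∀ t ∈ Finset.Icc 1 T, 0 ≤ ∑ e, x (t - 1) e * y t e) :
    ∀ e : Fin m,
      (∑ t ∈ Finset.Icc 1 T, y t e) + η * ∑ t ∈ Finset.Icc 1 T, |y t e|
        ≥ -(Real.log m) / η := by
  intro e
  have hz : ∀ t ∈ Finset.Icc 1 T, ∀ e, |η * y t e| ≤ 1 / 2 := by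
    intro t ht e
    rw [abs_mul, abs_of_pos hη0]
    have := hybound t ht e
    nlinarith [abs_nonneg (y t e)]
  have key : ∀ n, n ≤ T → (∀ e, 0 < x n e) ∧ (∑ e, x n e) ≤ m ∧
      ∀ e, -η * ((∑ t ∈ Finset.Icc 1 n, y t e) + η * ∑ t ∈ Finset.Icc 1 n, |y t e|)
        ≤ Real.log (x n e) := by
    intro n
    induction n with
    | zero => intro _; simp [hx0]
    | succ k ih =>
      intro hk
      obtain ⟨h1, h2, h3⟩ := ih (by omega)
      have hm : k + 1 ∈ Finset.Icc 1 T := by simp; omega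
      have hx := hxt (k + 1) hm
      have ha := havg (k + 1) hm
      simp only [Nat.add_sub_cancel] at hx ha
      have hp : ∀ e, 0 < 1 - η * y (k + 1) e := fun e => by
        have := (abs_le.mp (hz _ hm e)).2
        linarith
      refine ⟨fun e => by rw [hx]; exact mul_pos (h1 e) (hp e), ?_, fun e => ?_⟩
      · have : ∑ e, x (k + 1) e = ∑ e, x k e - η * ∑ e, x k e * y (k + 1) e := by
          rw [Finset.mul_sum, ← Finset.sum_sub_distrib]
          exact Finset.sum_congr rfl fun e _ => by rw [hx]; ring
        rw [this]
        nlinarith [mul_nonneg hη0.le ha]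
      · rw [hx, Real.log_mul (h1 e).ne' (hp e).ne', Finset.sum_Icc_succ_top (by omega),
          Finset.sum_Icc_succ_top (by omega)]
        have hl := mwu_log_aux _ (hz _ hm e)
        have h4 : (y (k + 1) e) ^ 2 ≤ |y (k + 1) e| := by
          rw [← sq_abs]
          nlinarith [abs_nonneg (y (k + 1) e), hybound _ hm e]
        have h5 := mul_le_mul_of_nonneg_left h4 (sq_nonneg η)
        have h6 := h3 e
        nlinarith
  obtain ⟨h1, h2, h3⟩ := key T le_rfl
  have h4 : x T e ≤ m :=
    (Finset.single_le_sum (f := x T) (fun i _ => (h1 i).le) (Finset.mem_univ e)).trans h2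
  have h5 := (h3 e).trans (Real.log_le_log (h1 e) h4)
  rw [ge_iff_le, div_le_iff₀ hη0]
  linarith
end

section
/- Let G be a connected undirected graph with n vertices and m ≥ 2 edges, with incidence matrix B. Suppose there is a constant α ≥ 1 such that the localization inequality holds uniformly: for every positive edge weighting w ∈ ℝ^m_{>0} with weighted Laplacian L_w = B ᵀ diag(w) B, and every vector ℓ ∈ ℝ^m_{≥0}, Σ_{e,f∈E} ℓ_e ℓ_f √(w_e w_f) |b_e L_w⁺ b_fᵀ| ≤ α · ‖ℓ‖₂². Then there exist a positive integer T ≤ ⌈100 · √m · ln m⌉ and positive edge weightings w^{(1)}, …, w^{(T)} ∈ ℝ^m_{>0} such that the uniform convex combination of the corresponding electrical routings has load at most 8α on every edge: for every edge e, (1/T) · Σ_{t=1}^{T} load_{w^{(t)}}(e) ≤ 8α. -/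
open Matrix

lemma exists_mp {k : ℕ} (A : Matrix (Fin k) (Fin k) ℝ) (hA : A.IsHermitian) :
    ∃ P : Matrix (Fin k) (Fin k) ℝ, Pᵀ = P ∧ IsMoorePenrose A P := by
  set U : Matrix (Fin k) (Fin k) ℝ := (hA.eigenvectorUnitary : Matrix (Fin k) (Fin k) ℝ) with hU
  set d : Fin k → ℝ := hA.eigenvalues with hd
  have h1 : Uᵀ * U = 1 := by
    have := Unitary.coe_star_mul_self hA.eigenvectorUnitary
    rwa [Matrix.star_eq_conjTranspose, Matrix.conjTranspose_eq_transpose_of_trivial] at this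
  have hs : A = U * diagonal d * Uᵀ := by
    have := hA.spectral_theorem
    rw [Unitary.conjStarAlgAut_apply, Matrix.star_eq_conjTranspose,
      Matrix.conjTranspose_eq_transpose_of_trivial] at this
    exact this
  have key : ∀ a b : Fin k → ℝ, (U * diagonal a * Uᵀ) * (U * diagonal b * Uᵀ)
      = U * diagonal (fun i => a i * b i) * Uᵀ := by
    intro a b
    calc (U * diagonal a * Uᵀ) * (U * diagonal b * Uᵀ)
        = U * diagonal a * (Uᵀ * U) * diagonal b * Uᵀ := by simp only [Matrix.mul_assoc]
      _ = _ := by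
        rw [h1, Matrix.mul_one, Matrix.mul_assoc U, Matrix.diagonal_mul_diagonal]
  have kt : ∀ a : Fin k → ℝ, (U * diagonal a * Uᵀ)ᵀ = U * diagonal a * Uᵀ := by
    intro a
    simp [Matrix.transpose_mul, Matrix.mul_assoc]
  refine ⟨U * diagonal (fun i => (d i)⁻¹) * Uᵀ, kt _, ?_⟩
  rw [hs]
  unfold IsMoorePenrose
  simp only [key, kt]
  refine ⟨?_, ?_, trivial, trivial⟩
  · congr 3
    funext i
    exact mul_inv_mul_cancel (d i)
  · congr 3
    funext i
    by_cases h : d i = 0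
    · simp [h]
    · field_simp

lemma step_oracle {n m : ℕ} (hm : 2 ≤ m) (B : Matrix (Fin m) (Fin n) ℝ)
    (α : ℝ) (hα : 1 ≤ α)
    (hloc : ∀ w : Fin m → ℝ, (∀ e, 0 < w e) →
      ∀ P : Matrix (Fin n) (Fin n) ℝ,
        IsMoorePenrose (Bᵀ * Matrix.diagonal w * B) P →
        ∀ l : Fin m → ℝ, (∀ e, 0 ≤ l e) →
          ∑ e : Fin m, ∑ f : Fin m,
              l e * l f * Real.sqrt (w e * w f) * |(B * P * Bᵀ) e f|
            ≤ α * ∑ e : Fin m, (l e) ^ 2)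
    (x : Fin m → ℝ) (hx : ∀ e, 0 < x e) :
    ∃ w : Fin m → ℝ, ∃ P : Matrix (Fin n) (Fin n) ℝ, (∀ e, 0 < w e) ∧
      IsMoorePenrose (Bᵀ * Matrix.diagonal w * B) P ∧
      (∀ e, w e * ∑ f : Fin m, |(B * P * Bᵀ) e f| ≤ Real.sqrt (2 * m)) ∧
      ∑ e, x e * (w e * ∑ f : Fin m, |(B * P * Bᵀ) e f|) ≤ 2 * α * ∑ e, x e := by
  have hm0 : (0 : ℝ) < m := by
    have : 0 < m := by omega
    exact_mod_cast this
  have : Nonempty (Fin m) := ⟨⟨0, by omega⟩⟩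
  set X : ℝ := ∑ e, x e with hX
  have hXpos : 0 < X := Finset.sum_pos (fun e _ => hx e) Finset.univ_nonempty
  set p : Fin m → ℝ := fun e => (x e / X + 1 / m) / 2 with hp
  have hp1 : ∀ e, 1 / (2 * m) ≤ p e := by
    intro e
    have h : 0 ≤ x e / X := (div_pos (hx e) hXpos).le
    have : (1 : ℝ) / (2 * m) = (1 / m) / 2 := by field_simp
    simp only [hp]
    linarith
  have hp0 : ∀ e, 0 < p e := fun e => lt_of_lt_of_le (by positivity) (hp1 e)
  have hxp : ∀ e, x e ≤ 2 * X * p e := by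
    intro e
    have h : (2 * X * p e) = x e + X / m := by
      simp only [hp]; field_simp
    rw [h]
    have : 0 < X / m := by positivity
    linarith
  have hps : ∑ e, p e = 1 := by
    simp only [hp]
    rw [← Finset.sum_div, Finset.sum_add_distrib, ← Finset.sum_div, ← hX]
    simp
    field_simp
    norm_num
  set w : Fin m → ℝ := fun e => (p e)⁻¹ with hw
  have hw0 : ∀ e, 0 < w e := fun e => inv_pos.mpr (hp0 e)
  have hwm : ∀ e, w e ≤ 2 * m := by
    intro e
    have := inv_anti₀ (by positivity) (hp1 e)
    simpa using this
  have hherm : (Bᵀ * Matrix.diagonal w * B).IsHermitian := by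
    unfold Matrix.IsHermitian
    rw [Matrix.conjTranspose_eq_transpose_of_trivial]
    simp [Matrix.transpose_mul, Matrix.mul_assoc]
  obtain ⟨P, hPt, hP⟩ := exists_mp _ hherm
  set M := B * P * Bᵀ with hM
  have hMt : ∀ e f, M e f = M f e := by
    intro e f
    have : Mᵀ = M := by
      simp [hM, Matrix.transpose_mul, Matrix.mul_assoc, hPt]
    exact congrFun (congrFun this f) e
  have hMM : M * diagonal w * M = M := by
    have h2 := hP.2.1
    calc M * diagonal w * M = B * (P * (Bᵀ * Matrix.diagonal w * B) * P) * Bᵀ := by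
          simp only [hM, Matrix.mul_assoc]
      _ = M := by rw [h2]
  have hdiag : ∀ e, ∑ f, w f * (M e f) ^ 2 = M e e := by
    intro e
    have := congrFun (congrFun hMM e) e
    rw [Matrix.mul_apply] at this
    rw [← this]
    refine Finset.sum_congr rfl fun f _ => ?_
    rw [Matrix.mul_diagonal, hMt f e]
    ring
  have hM0 : ∀ e, 0 ≤ M e e := by
    intro e
    rw [← hdiag e]
    exact Finset.sum_nonneg fun f _ => mul_nonneg (hw0 f).le (sq_nonneg _)
  have hM1 : ∀ e, w e * M e e ≤ 1 := by
    intro e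
    have h : w e * (M e e) ^ 2 ≤ M e e := by
      conv_rhs => rw [← hdiag e]
      exact Finset.single_le_sum (f := fun f => w f * (M e f) ^ 2)
        (fun f _ => mul_nonneg (hw0 f).le (sq_nonneg _)) (Finset.mem_univ e)
    rcases (hM0 e).eq_or_lt with h0 | h0
    · rw [← h0]; simp
    · by_contra! hc
      nlinarith
  refine ⟨w, P, hw0, hP, ?_, ?_⟩
  · intro e
    apply Real.le_sqrt_of_sq_le
    have hcs : (∑ f, |M e f|) ^ 2 ≤ (∑ f, p f) * ∑ f, w f * (M e f) ^ 2 := by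
      apply Finset.sum_sq_le_sum_mul_sum_of_sq_eq_mul
      · intro f _; exact (hp0 f).le
      · intro f _; exact mul_nonneg (hw0 f).le (sq_nonneg _)
      · intro f _
        have := (hp0 f).ne'
        simp only [hw, sq_abs]
        field_simp
    rw [hps, hdiag, one_mul] at hcs
    rw [mul_pow]
    calc w e ^ 2 * (∑ f, |M e f|) ^ 2 ≤ w e ^ 2 * M e e := by gcongr
      _ = w e * (w e * M e e) := by ring
      _ ≤ w e * 1 := mul_le_mul_of_nonneg_left (hM1 e) (hw0 e).le
      _ ≤ 2 * m := by simpa using hwm e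
  · have hl := hloc w hw0 P hP (fun e => Real.sqrt (p e)) (fun e => Real.sqrt_nonneg _)
    have e1 : ∑ e, (Real.sqrt (p e)) ^ 2 = 1 := by
      rw [← hps]
      exact Finset.sum_congr rfl fun e _ => Real.sq_sqrt (hp0 e).le
    have e2 : ∀ e f, Real.sqrt (p e) * Real.sqrt (p f) * Real.sqrt (w e * w f) = 1 := by
      intro e f
      rw [← Real.sqrt_mul (hp0 e).le, ← Real.sqrt_mul (mul_pos (hp0 e) (hp0 f)).le]
      rw [Real.sqrt_eq_one]
      have := (hp0 e).ne'
      have := (hp0 f).ne'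
      simp only [hw]
      field_simp
    simp only [e1, e2, one_mul, mul_one] at hl
    calc ∑ e, x e * (w e * ∑ f : Fin m, |M e f|)
        ≤ ∑ e, (2 * X * p e) * (w e * ∑ f : Fin m, |M e f|) := by
          refine Finset.sum_le_sum fun e _ => ?_
          exact mul_le_mul_of_nonneg_right (hxp e)
            (mul_nonneg (hw0 e).le (Finset.sum_nonneg fun f _ => abs_nonneg _))
      _ = 2 * X * ∑ e, ∑ f : Fin m, |M e f| := by
          rw [Finset.mul_sum Finset.univ (fun e => ∑ f : Fin m, |M e f|) (2 * X)]
          refine Finset.sum_congr rfl fun e _ => ?_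
          have := (hp0 e).ne'
          simp only [hw]
          field_simp
      _ ≤ 2 * X * α := mul_le_mul_of_nonneg_left hl (by positivity)
      _ = 2 * α * X := by ring

lemma exp_le_one_add_two_mul {x : ℝ} (h0 : 0 ≤ x) (h1 : x ≤ 1) : Real.exp x ≤ 1 + 2 * x := by
  have := Real.abs_exp_sub_one_le (x := x) (by rwa [abs_of_nonneg h0])
  rw [abs_of_nonneg h0] at this
  linarith [le_abs_self (Real.exp x - 1)]

lemma mwu {m : ℕ} (hm : 2 ≤ m) (α ρ : ℝ) (hρ : 0 < ρ)
    (F : (Fin m → ℝ) → Fin m → ℝ)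
    (hF0 : ∀ S e, 0 ≤ F S e) (hF1 : ∀ S e, F S e ≤ ρ)
    (hF2 : ∀ S : Fin m → ℝ, ∑ e, Real.exp (S e / ρ) * F S e
      ≤ 2 * α * ∑ e, Real.exp (S e / ρ)) :
    ∃ S : ℕ → Fin m → ℝ, ∀ (t : ℕ) (e : Fin m),
      ∑ i : Fin t, F (S i) e ≤ ρ * Real.log m + 4 * α * t := by
  let S : ℕ → Fin m → ℝ := fun t => Nat.rec (fun _ => 0) (fun _ s => fun e => s e + F s e) t
  have hS : ∀ t e, S (t + 1) e = S t e + F (S t) e := fun t e => rfl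
  have hSsum : ∀ t e, ∑ i : Fin t, F (S i) e = S t e := by
    intro t e
    induction t with
    | zero => simp [S]
    | succ t ih => rw [Fin.sum_univ_castSucc, hS, ← ih]; simp
  have hm0 : (0 : ℝ) < m := by
    have : 0 < m := by omega
    exact_mod_cast this
  have hΦ : ∀ t : ℕ, ∑ e, Real.exp (S t e / ρ) ≤ m * Real.exp (4 * α * t / ρ) := by
    intro t
    induction t with
    | zero => simp [S]
    | succ t ih =>
      have hn : 0 ≤ ∑ e, Real.exp (S t e / ρ) :=
        Finset.sum_nonneg fun e _ => (Real.exp_pos _).le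
      calc ∑ e, Real.exp (S (t + 1) e / ρ)
          ≤ ∑ e, (Real.exp (S t e / ρ) + 2 / ρ * (Real.exp (S t e / ρ) * F (S t) e)) := by
            refine Finset.sum_le_sum fun e _ => ?_
            rw [hS, add_div, Real.exp_add]
            have := exp_le_one_add_two_mul (div_nonneg (hF0 (S t) e) hρ.le)
              ((div_le_one hρ).mpr (hF1 (S t) e))
            calc _ ≤ Real.exp (S t e / ρ) * (1 + 2 * (F (S t) e / ρ)) := by gcongr
              _ = _ := by ring
        _ = ∑ e, Real.exp (S t e / ρ) + 2 / ρ * ∑ e, Real.exp (S t e / ρ) * F (S t) e := by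
            rw [Finset.sum_add_distrib, Finset.mul_sum]
        _ ≤ ∑ e, Real.exp (S t e / ρ) + 2 / ρ * (2 * α * ∑ e, Real.exp (S t e / ρ)) := by
            have := hF2 (S t)
            gcongr
        _ = (∑ e, Real.exp (S t e / ρ)) * (4 * α / ρ + 1) := by ring
        _ ≤ (∑ e, Real.exp (S t e / ρ)) * Real.exp (4 * α / ρ) := by
            have := Real.add_one_le_exp (4 * α / ρ)
            gcongr
        _ ≤ (m * Real.exp (4 * α * t / ρ)) * Real.exp (4 * α / ρ) := by gcongr
        _ = m * Real.exp (4 * α * (t + 1 : ℕ) / ρ) := by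
            rw [mul_assoc, ← Real.exp_add]
            congr 2
            push_cast
            ring
  refine ⟨S, fun t e => ?_⟩
  rw [hSsum]
  have h1 : Real.exp (S t e / ρ) ≤ m * Real.exp (4 * α * t / ρ) :=
    (Finset.single_le_sum (f := fun e => Real.exp (S t e / ρ))
      (fun e _ => (Real.exp_pos _).le) (Finset.mem_univ e)).trans (hΦ t)
  have h2 : Real.exp (S t e / ρ) ≤ Real.exp (Real.log m + 4 * α * t / ρ) := by
    rwa [Real.exp_add, Real.exp_log hm0]
  have h3 := Real.exp_le_exp.mp h2
  rw [div_le_iff₀ hρ] at h3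
  have : (Real.log m + 4 * α * t / ρ) * ρ = ρ * Real.log m + 4 * α * t := by
    field_simp
  linarith

/-- the main existence theorem. If the localization inequality
holds with constant `α ≥ 1` uniformly over all positive weightings, then there
are `T ≤ ⌈100 √m ln m⌉` positive weightings whose uniform convex combination of
electrical routings has load at most `8α` on every edge (hence competitive
ratio at most `8α` for congestion). -/
theorem oblivious_routing_from_electrical_flows {n m : ℕ} (hm : 2 ≤ m)
    (ends : Fin m → Fin n × Fin n)
    (hloop : ∀ e, (ends e).1 ≠ (ends e).2)
    (hsimple : Function.Injective fun e => s((ends e).1, (ends e).2))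
    (hconn : (graphOf ends).Connected)
    (α : ℝ) (hα : 1 ≤ α)
    (hloc : ∀ w : Fin m → ℝ, (∀ e, 0 < w e) →
      ∀ P : Matrix (Fin n) (Fin n) ℝ,
        IsMoorePenrose ((incB ends)ᵀ * Matrix.diagonal w * incB ends) P →
        ∀ l : Fin m → ℝ, (∀ e, 0 ≤ l e) →
          ∑ e : Fin m, ∑ f : Fin m,
              l e * l f * Real.sqrt (w e * w f) * |(incB ends * P * (incB ends)ᵀ) e f|
            ≤ α * ∑ e : Fin m, (l e) ^ 2) :
    ∃ T : ℕ, 0 < T ∧ T ≤ ⌈(100 : ℝ) * Real.sqrt m * Real.log m⌉₊ ∧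
      ∃ ws : Fin T → Fin m → ℝ, (∀ t e, 0 < ws t e) ∧
        ∃ Ps : Fin T → Matrix (Fin n) (Fin n) ℝ,
          (∀ t, IsMoorePenrose
              ((incB ends)ᵀ * Matrix.diagonal (ws t) * incB ends) (Ps t)) ∧
          ∀ e : Fin m,
            (1 / (T : ℝ)) * ∑ t : Fin T,
                ws t e * ∑ f : Fin m, |(incB ends * Ps t * (incB ends)ᵀ) e f|
              ≤ 8 * α := by
  have H := fun S : Fin m → ℝ => step_oracle hm (incB ends) α hα hloc
    (fun e => Real.exp (S e / Real.sqrt (2 * m))) (fun e => Real.exp_pos _)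
  choose W P hW hP h1 h2 using H
  have hm1 : (1 : ℝ) < m := by
    have : 1 < m := by omega
    exact_mod_cast this
  have hρ : 0 < Real.sqrt (2 * m) := Real.sqrt_pos.mpr (by linarith)
  obtain ⟨S, hS⟩ := mwu hm α (Real.sqrt (2 * m)) hρ
    (fun S e => W S e * ∑ f : Fin m, |(incB ends * P S * (incB ends)ᵀ) e f|)
    (fun S e => mul_nonneg (hW S e).le (Finset.sum_nonneg fun f _ => abs_nonneg _)) h1 h2
  have hlog : 0 < Real.log m := Real.log_pos hm1
  have hsq : 0 < Real.sqrt m := Real.sqrt_pos.mpr (by linarith)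
  have hpos : 0 < (100 : ℝ) * Real.sqrt m * Real.log m := by positivity
  have hT : 0 < ⌈(100 : ℝ) * Real.sqrt m * Real.log m⌉₊ := Nat.ceil_pos.mpr hpos
  have hTle := Nat.le_ceil ((100 : ℝ) * Real.sqrt m * Real.log m)
  refine ⟨⌈(100 : ℝ) * Real.sqrt m * Real.log m⌉₊, hT, le_rfl,
    fun t => W (S t), fun t => hW _, fun t => P (S t), fun t => hP _, fun e => ?_⟩
  have hb := hS ⌈(100 : ℝ) * Real.sqrt m * Real.log m⌉₊ e
  generalize ⌈(100 : ℝ) * Real.sqrt m * Real.log m⌉₊ = T at *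
  have hT' : (0 : ℝ) < T := by exact_mod_cast hT
  rw [one_div, inv_mul_le_iff₀ hT']
  refine hb.trans ?_
  have hs2 : Real.sqrt (2 * m) ≤ 2 * Real.sqrt m := by
    rw [Real.sqrt_mul (by norm_num)]
    have : Real.sqrt 2 ≤ 2 := by
      rw [Real.sqrt_le_left (by norm_num)]; norm_num
    gcongr
  have h3 : Real.sqrt (2 * m) * Real.log m ≤ 2 * Real.sqrt m * Real.log m := by gcongr
  have h4 : (T : ℝ) ≤ T * α := by nlinarith
  have h5 : 0 < Real.sqrt m * Real.log m := by positivity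
  nlinarith
end
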